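/- arXiv:1603.02959 — 2 statements merged into one kernel-verified Lean document; each statement's English description precedes it below -/
import Mathlib

section
/- Let (a_i)_{i≥1} be a sequence of positive real numbers and let (k_n)_{n≥1} be a sequence of natural numbers with k_n → ∞ as n → ∞. Let (x_i^n)_{i≥1, n≥1} be a doubly indexed sequence of real numbers and let x ∈ ℝ. Assume: (i) lim_{n→∞} Σ_{i=1}^{k_n} a_i = +∞; (ii) the joint double limit of x_i^n equals x, i.e. for every ε > 0 there exists N such that |x_i^n − x| ≤ ε whenever i ≥ N and n ≥ N, and in addition for every fixed i the limit lim_{n→∞} x_i^n exists. Then lim_{n→∞} (Σ_{i=1}^{k_n} a_i x_i^n) / (Σ_{i=1}^{k_n} a_i) = x. -/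
open Filter Topology

/-- Extended (doubly indexed) version of the Toeplitz lemma. -/
theorem stmt_0 (a : ℕ → ℝ) (ha : ∀ i, 0 < a i)
    (k : ℕ → ℕ) (hk : Tendsto k atTop atTop)
    (x : ℕ → ℕ → ℝ) (xlim : ℝ)
    (h1 : Tendsto (fun n => ∑ i ∈ Finset.range (k n), a i) atTop atTop)
    (h2 : ∀ ε > (0 : ℝ), ∃ N : ℕ, ∀ i ≥ N, ∀ n ≥ N, |x i n - xlim| ≤ ε)
    (h3 : ∀ i, ∃ L : ℝ, Tendsto (fun n => x i n) atTop (𝓝 L)) :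
    Tendsto (fun n => (∑ i ∈ Finset.range (k n), a i * x i n) /
      (∑ i ∈ Finset.range (k n), a i)) atTop (𝓝 xlim) := by
  choose L hL using h3
  refine Metric.tendsto_nhds.2 fun ε hε => ?_
  obtain ⟨N, hN⟩ := h2 (ε / 2) (half_pos hε)
  -- The first `N` terms converge, so they are negligible against the divergent total weight.
  have hhead : Tendsto (fun n => ∑ i ∈ Finset.range N, a i * |x i n - xlim|) atTop
      (𝓝 (∑ i ∈ Finset.range N, a i * |L i - xlim|)) :=
    tendsto_finsetSum _ fun i _ => (((hL i).sub_const xlim).abs).const_mul (a i)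
  have hsmall := (hhead.div_atTop h1).eventually_lt_const (half_pos hε)
  filter_upwards [hsmall, h1.eventually_gt_atTop 0, hk.eventually_ge_atTop N,
    eventually_ge_atTop N] with n hn hS hkn hnN
  have hdiff : (∑ i ∈ Finset.range (k n), a i * x i n) / (∑ i ∈ Finset.range (k n), a i) - xlim
      = (∑ i ∈ Finset.range (k n), a i * (x i n - xlim)) / (∑ i ∈ Finset.range (k n), a i) := by
    simp only [mul_sub, Finset.sum_sub_distrib, ← Finset.sum_mul]
    field_simp
  rw [Real.dist_eq, hdiff, abs_div, abs_of_pos hS, div_lt_iff₀ hS]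
  rw [div_lt_iff₀ hS] at hn
  have htail : ∑ i ∈ Finset.Ico N (k n), a i * |x i n - xlim|
      ≤ ε / 2 * ∑ i ∈ Finset.range (k n), a i := by
    calc ∑ i ∈ Finset.Ico N (k n), a i * |x i n - xlim|
        ≤ ∑ i ∈ Finset.Ico N (k n), ε / 2 * a i := by
          refine Finset.sum_le_sum fun i hi => ?_
          rw [mul_comm]
          exact mul_le_mul_of_nonneg_right (hN i (Finset.mem_Ico.1 hi).1 n hnN) (ha i).le
      _ ≤ ∑ i ∈ Finset.range (k n), ε / 2 * a i :=
          Finset.sum_le_sum_of_subset_of_nonneg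
            (fun i hi => Finset.mem_range.2 (Finset.mem_Ico.1 hi).2)
            fun i _ _ => (mul_pos (half_pos hε) (ha i)).le
      _ = ε / 2 * ∑ i ∈ Finset.range (k n), a i := (Finset.mul_sum _ _ _).symm
  calc |∑ i ∈ Finset.range (k n), a i * (x i n - xlim)|
      ≤ ∑ i ∈ Finset.range (k n), |a i * (x i n - xlim)| := Finset.abs_sum_le_sum_abs _ _
    _ = ∑ i ∈ Finset.range (k n), a i * |x i n - xlim| := by
        simp only [abs_mul, abs_of_pos (ha _)]
    _ = ∑ i ∈ Finset.range N, a i * |x i n - xlim|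
          + ∑ i ∈ Finset.Ico N (k n), a i * |x i n - xlim| :=
        (Finset.sum_range_add_sum_Ico _ hkn).symm
    _ < ε * ∑ i ∈ Finset.range (k n), a i := by linarith
end

section
/- Let W : Ω → ℝ^q be an arbitrary random vector and Y : Ω → ℝ a measurable random variable with P(Y ≠ 0) > 0. Then v(θ) → +∞ as ‖θ‖ → ∞; that is, for every sequence (θ_k)_{k≥1} in ℝ^q with ‖θ_k‖ → ∞ one has lim_{k→∞} E[Y² · exp(−⟨θ_k, W⟩ + ‖θ_k‖²T/2)] = +∞, the expectations being understood as integrals of nonnegative functions with values in [0, +∞]. -/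
open MeasureTheory ProbabilityTheory Real Filter Topology
open scoped RealInnerProductSpace ENNReal

/-- If nonnegative measurable functions tend to `∞` pointwise on a set of positive measure, then
their integrals tend to `∞`. -/
theorem tendsto_lintegral_nhds_top {α : Type*} [MeasurableSpace α] {μ : Measure α}
    {f : ℕ → α → ℝ≥0∞} {s : Set α} (hf : ∀ n, Measurable (f n)) (hs : MeasurableSet s)
    (hμs : μ s ≠ 0) (h : ∀ x ∈ s, Tendsto (fun n => f n x) atTop (𝓝 ⊤)) :
    Tendsto (fun n => ∫⁻ x, f n x ∂μ) atTop (𝓝 ⊤) := by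
  refine tendsto_of_le_liminf_of_limsup_le ?_ le_top
  calc (⊤ : ℝ≥0∞) = ∫⁻ _ in s, ⊤ ∂μ := by
        rw [setLIntegral_const, ENNReal.top_mul hμs]
    _ = ∫⁻ x in s, liminf (fun n => f n x) atTop ∂μ :=
        setLIntegral_congr_fun hs fun x hx => (h x hx).liminf_eq.symm
    _ ≤ ∫⁻ x, liminf (fun n => f n x) atTop ∂μ := setLIntegral_le_lintegral _ _
    _ ≤ liminf (fun n => ∫⁻ x, f n x ∂μ) atTop := lintegral_liminf_le hf

/-- A positive multiple of the squared norm dominates any linear functional at infinity. -/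
theorem tendsto_neg_inner_add_sq_norm_atTop {E ι : Type*} [NormedAddCommGroup E]
    [InnerProductSpace ℝ E] {l : Filter ι} {θ : ι → E} {T : ℝ} (hT : 0 < T) (w : E)
    (hθ : Tendsto (fun k => ‖θ k‖) l atTop) :
    Tendsto (fun k => -⟪θ k, w⟫ + ‖θ k‖ ^ 2 * T / 2) l atTop := by
  have h : Tendsto (fun k => ‖θ k‖ * (‖θ k‖ * (T / 2) + -‖w‖)) l atTop :=
    hθ.atTop_mul_atTop₀ (tendsto_atTop_add_const_right l _ (hθ.atTop_mul_const (half_pos hT)))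
  refine tendsto_atTop_mono (fun k => ?_) h
  linarith [real_inner_le_norm (θ k) w]

/-- Coercivity: if `P(Y ≠ 0) > 0`, then along any sequence `θ_k` with `‖θ_k‖ → ∞`,
`E[Y² exp(−⟨θ_k, W⟩ + ‖θ_k‖²T/2)] → +∞` (expectations in `[0, ∞]`). -/
theorem stmt_4
    {q : ℕ} (hq : 1 ≤ q) {T : ℝ} (hT : 0 < T)
    {Ω : Type*} [MeasureSpace Ω] [IsProbabilityMeasure (ℙ : Measure Ω)]
    (W : Ω → EuclideanSpace ℝ (Fin q)) (Y : Ω → ℝ)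
    (hW : Measurable W) (hY : Measurable Y)
    (hY0 : 0 < ℙ {ω | Y ω ≠ 0}) :
    ∀ θ : ℕ → EuclideanSpace ℝ (Fin q),
      Tendsto (fun k => ‖θ k‖) atTop atTop →
      Tendsto (fun k =>
          ∫⁻ ω, ENNReal.ofReal (Y ω ^ 2 * exp (-⟪θ k, W ω⟫ + ‖θ k‖ ^ 2 * T / 2)) ∂ℙ)
        atTop (𝓝 ⊤) := by
  intro θ hθ
  refine tendsto_lintegral_nhds_top (s := {ω | Y ω ≠ 0}) (fun k => by fun_prop)
    (hY (measurableSet_singleton 0).compl) hY0.ne' fun ω hω => ?_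
  exact ENNReal.tendsto_ofReal_nhds_top.2 <|
    (tendsto_exp_atTop.comp (tendsto_neg_inner_add_sq_norm_atTop hT (W ω) hθ)).const_mul_atTop
      (sq_pos_of_ne_zero hω)
end
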